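/- arXiv:2204.13247 — 3 statements merged into one kernel-verified Lean document; each statement's English description precedes it below -/
import Mathlib

section
/- Fix x ∈ ℝ² with 0 < ‖x‖ < 1. The function y ↦ (1/(2π))·ln(‖x - y‖/(‖y‖·‖x - y/‖y‖²‖)) is harmonic on the open set {y ∈ ℝ² : 0 < ‖y‖ < 1, y ≠ x}; that is, the unit-disc Green's function G(x,·) is harmonic in its second argument away from the singular point y = x (and the origin). -/
open Real

/-- Replace the `i`-th coordinate of a point of Euclidean space by `t`. -/
noncomputable def updateCoord {n : ℕ} (y : EuclideanSpace ℝ (Fin n)) (i : Fin n) (t : ℝ) :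
    EuclideanSpace ℝ (Fin n) :=
  (WithLp.equiv 2 (Fin n → ℝ)).symm (Function.update (WithLp.equiv 2 (Fin n → ℝ) y) i t)

/-- The Green's function of the unit disc for the Poisson equation:
`G(x,y) = (1/(2π)) ln (‖x - y‖ / (‖y‖ · ‖x - y/‖y‖²‖))`. -/
noncomputable def greenDisc (x y : EuclideanSpace ℝ (Fin 2)) : ℝ :=
  (1 / (2 * Real.pi)) * Real.log (‖x - y‖ / (‖y‖ * ‖x - (‖y‖ ^ 2)⁻¹ • y‖))


/-- Squared distance polynomial. -/
noncomputable def gN (a b u v : ℝ) : ℝ := (a - u) ^ 2 + (b - v) ^ 2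

/-- Squared distance to the reflected point times the squared norm. -/
noncomputable def gD (a b u v : ℝ) : ℝ :=
  (u ^ 2 + v ^ 2) * (a ^ 2 + b ^ 2) - 2 * (a * u + b * v) + 1

lemma normsq2 (x : EuclideanSpace ℝ (Fin 2)) : ‖x‖ ^ 2 = x 0 ^ 2 + x 1 ^ 2 := by
  rw [EuclideanSpace.norm_sq_eq]; simp

lemma gN_pos (x y : EuclideanSpace ℝ (Fin 2)) (h : y ≠ x) :
    0 < gN (x 0) (x 1) (y 0) (y 1) := by
  have h1 : 0 < ‖x - y‖ ^ 2 := by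
    have : x - y ≠ 0 := sub_ne_zero.2 h.symm
    positivity
  rw [normsq2] at h1
  simpa [gN] using h1

lemma gD_pos (x y : EuclideanSpace ℝ (Fin 2)) (hx1 : ‖x‖ < 1) (hy1 : ‖y‖ < 1) :
    0 < gD (x 0) (x 1) (y 0) (y 1) := by
  have hx : x 0 ^ 2 + x 1 ^ 2 < 1 := by
    rw [← normsq2]; nlinarith [norm_nonneg x]
  have hy : y 0 ^ 2 + y 1 ^ 2 < 1 := by
    rw [← normsq2]; nlinarith [norm_nonneg y]
  have : gD (x 0) (x 1) (y 0) (y 1) = (1 - (x 0 ^ 2 + x 1 ^ 2)) * (1 - (y 0 ^ 2 + y 1 ^ 2))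
      + ((x 0 - y 0) ^ 2 + (x 1 - y 1) ^ 2) := by unfold gD; ring
  rw [this]
  have := mul_pos (sub_pos.2 hx) (sub_pos.2 hy)
  positivity

lemma green_eq (x y : EuclideanSpace ℝ (Fin 2)) (hx1 : ‖x‖ < 1)
    (hy0 : 0 < ‖y‖) (hy1 : ‖y‖ < 1) (hne : y ≠ x) :
    greenDisc x y = (1 / (4 * Real.pi)) * (Real.log (gN (x 0) (x 1) (y 0) (y 1))
      - Real.log (gD (x 0) (x 1) (y 0) (y 1))) := by
  have hN := gN_pos x y hne
  have hD := gD_pos x y hx1 hy1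
  have e1 : ‖x - y‖ ^ 2 = gN (x 0) (x 1) (y 0) (y 1) := by rw [normsq2]; simp [gN]
  have e2 : (‖y‖ * ‖x - (‖y‖ ^ 2)⁻¹ • y‖) ^ 2 = gD (x 0) (x 1) (y 0) (y 1) := by
    have hs : 0 < ‖y‖ ^ 2 := by positivity
    rw [mul_pow, normsq2 (x - _)]
    have hq := normsq2 y
    simp only [PiLp.sub_apply, PiLp.smul_apply, smul_eq_mul, gD]
    rw [← hq]
    generalize ‖y‖ ^ 2 = s at *
    field_simp
    rw [hq]; ring
  unfold greenDisc
  rw [← e1, ← e2]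
  have p1 : ‖x - y‖ ≠ 0 := by intro h; rw [h] at e1; norm_num at e1; linarith
  have p2 : ‖y‖ * ‖x - (‖y‖ ^ 2)⁻¹ • y‖ ≠ 0 := by
    intro h; rw [h] at e2; norm_num at e2; linarith
  rw [Real.log_div p1 p2, Real.log_pow, Real.log_pow]
  push_cast
  field_simp
  ring

lemma isOpen_dom (x : EuclideanSpace ℝ (Fin 2)) :
    IsOpen {y : EuclideanSpace ℝ (Fin 2) | 0 < ‖y‖ ∧ ‖y‖ < 1 ∧ y ≠ x} :=
  (isOpen_lt continuous_const continuous_norm).inter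
    ((isOpen_lt continuous_norm continuous_const).inter isOpen_ne)

/-- Second derivative of a difference of logarithms of quadratics. -/
lemma second_deriv (k a b c d e f t : ℝ) (h1 : 0 < a * t ^ 2 + b * t + c)
    (h2 : 0 < d * t ^ 2 + e * t + f) :
    iteratedDeriv 2 (fun t => k * (Real.log (a * t ^ 2 + b * t + c)
      - Real.log (d * t ^ 2 + e * t + f))) t =
    k * ((2 * a * (a * t ^ 2 + b * t + c) - (2 * a * t + b) ^ 2) / (a * t ^ 2 + b * t + c) ^ 2
      - (2 * d * (d * t ^ 2 + e * t + f) - (2 * d * t + e) ^ 2) / (d * t ^ 2 + e * t + f) ^ 2) := by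
  have hq : ∀ a b c t : ℝ, HasDerivAt (fun t => a * t ^ 2 + b * t + c) (2 * a * t + b) t := by
    intro a b c t
    have := (((hasDerivAt_pow 2 t).const_mul a).add ((hasDerivAt_id t).const_mul b)).add_const c
    refine this.congr_deriv ?_
    simp; ring
  have hl : ∀ a b t : ℝ, HasDerivAt (fun t => 2 * a * t + b) (2 * a) t := by
    intro a b t
    have := ((hasDerivAt_id t).const_mul (2 * a)).add_const b
    refine this.congr_deriv ?_
    simp
  have hc : ∀ a b c : ℝ, Continuous (fun t : ℝ => a * t ^ 2 + b * t + c) := by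
    intro a b c; fun_prop
  rw [show (2 : ℕ) = 1 + 1 from rfl, iteratedDeriv_succ, iteratedDeriv_one]
  have ev : deriv (fun t => k * (Real.log (a * t ^ 2 + b * t + c)
      - Real.log (d * t ^ 2 + e * t + f))) =ᶠ[nhds t]
      fun t => k * ((2 * a * t + b) / (a * t ^ 2 + b * t + c)
        - (2 * d * t + e) / (d * t ^ 2 + e * t + f)) := by
    filter_upwards [(hc a b c).continuousAt.eventually (lt_mem_nhds h1),
      (hc d e f).continuousAt.eventually (lt_mem_nhds h2)] with s s1 s2
    exact ((((hq a b c s).log s1.ne').sub ((hq d e f s).log s2.ne')).const_mul k).deriv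
  rw [ev.deriv_eq]
  refine (((((hl a b t).div (hq a b c t) h1.ne').sub
    ((hl d e t).div (hq d e f t) h2.ne')).const_mul k).congr_deriv ?_).deriv
  ring

theorem green_disc_harmonic (x : EuclideanSpace ℝ (Fin 2)) (hx0 : 0 < ‖x‖) (hx1 : ‖x‖ < 1) :
    ContDiffOn ℝ 2 (greenDisc x)
      {y : EuclideanSpace ℝ (Fin 2) | 0 < ‖y‖ ∧ ‖y‖ < 1 ∧ y ≠ x} ∧
    ∀ y : EuclideanSpace ℝ (Fin 2), 0 < ‖y‖ → ‖y‖ < 1 → y ≠ x →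
      (∑ i : Fin 2,
        iteratedDeriv 2 (fun t => greenDisc x (updateCoord y i t)) (y i)) = 0 := by
  constructor
  · refine ContDiffOn.congr (f := fun y : EuclideanSpace ℝ (Fin 2) =>
      (1 / (4 * Real.pi)) * (Real.log (gN (x 0) (x 1) (y 0) (y 1))
      - Real.log (gD (x 0) (x 1) (y 0) (y 1)))) ?_
      (fun y hy => green_eq x y hx1 hy.1 hy.2.1 hy.2.2)
    refine contDiffOn_const.mul (ContDiffOn.sub ?_ ?_)
    · refine ContDiffOn.log ?_ (fun y hy => (gN_pos x y hy.2.2).ne')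
      unfold gN; fun_prop
    · refine ContDiffOn.log ?_ (fun y hy => (gD_pos x y hx1 hy.2.1).ne')
      unfold gD; fun_prop
  · intro y hy0 hy1 hne
    have hN := gN_pos x y hne
    have hD := gD_pos x y hx1 hy1
    have ev : ∀ i : Fin 2, (fun t => greenDisc x (updateCoord y i t)) =ᶠ[nhds (y i)]
        fun t => (1 / (4 * Real.pi)) *
          (Real.log (gN (x 0) (x 1) (updateCoord y i t 0) (updateCoord y i t 1))
          - Real.log (gD (x 0) (x 1) (updateCoord y i t 0) (updateCoord y i t 1))) := by
      intro i
      have hc : Continuous (fun t => updateCoord y i t) := by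
        unfold updateCoord
        exact (PiLp.continuous_toLp 2 _).comp (continuous_const.update i continuous_id)
      have hy : updateCoord y i (y i) = y := by
        unfold updateCoord
        ext j; simp
      have hm : {y : EuclideanSpace ℝ (Fin 2) | 0 < ‖y‖ ∧ ‖y‖ < 1 ∧ y ≠ x}
          ∈ nhds (updateCoord y i (y i)) := by
        rw [hy]; exact (isOpen_dom x).mem_nhds ⟨hy0, hy1, hne⟩
      filter_upwards [hc.continuousAt.eventually hm] with t ht
      exact green_eq x _ hx1 ht.1 ht.2.1 ht.2.2
    rw [Fin.sum_univ_two, (ev 0).iteratedDeriv_eq, (ev 1).iteratedDeriv_eq]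
    have u00 : ∀ t, updateCoord y 0 t 0 = t := by intro t; simp [updateCoord]
    have u01 : ∀ t, updateCoord y 0 t 1 = y 1 := by intro t; simp [updateCoord]
    have u10 : ∀ t, updateCoord y 1 t 0 = y 0 := by intro t; simp [updateCoord]
    have u11 : ∀ t, updateCoord y 1 t 1 = t := by intro t; simp [updateCoord]
    simp only [u00, u01, u10, u11]
    generalize y 0 = u at *
    generalize y 1 = v at *
    generalize x 0 = a at *
    generalize x 1 = b at *
    have n0 : ∀ t, gN a b t v = 1 * t ^ 2 + (-2 * a) * t + (a ^ 2 + (b - v) ^ 2) := by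
      intro t; unfold gN; ring
    have n1 : ∀ t, gN a b u t = 1 * t ^ 2 + (-2 * b) * t + (b ^ 2 + (a - u) ^ 2) := by
      intro t; unfold gN; ring
    have d0 : ∀ t, gD a b t v = (a ^ 2 + b ^ 2) * t ^ 2 + (-2 * a) * t
        + (v ^ 2 * (a ^ 2 + b ^ 2) - 2 * b * v + 1) := by
      intro t; unfold gD; ring
    have d1 : ∀ t, gD a b u t = (a ^ 2 + b ^ 2) * t ^ 2 + (-2 * b) * t
        + (u ^ 2 * (a ^ 2 + b ^ 2) - 2 * a * u + 1) := by
      intro t; unfold gD; ring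
    have s0 := second_deriv (1 / (4 * Real.pi)) _ _ _ _ _ _ u (n0 u ▸ hN) (d0 u ▸ hD)
    have s1 := second_deriv (1 / (4 * Real.pi)) _ _ _ _ _ _ v (n1 v ▸ hN) (d1 v ▸ hD)
    simp only [← n0, ← d0] at s0
    simp only [← n1, ← d1] at s1
    rw [s0, s1, ← mul_add]
    have key1 : (2 * 1 * gN a b u v - (2 * 1 * u + -2 * a) ^ 2)
        + (2 * 1 * gN a b u v - (2 * 1 * v + -2 * b) ^ 2) = 0 := by unfold gN; ring
    have key2 : (2 * (a ^ 2 + b ^ 2) * gD a b u v - (2 * (a ^ 2 + b ^ 2) * u + -2 * a) ^ 2)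
        + (2 * (a ^ 2 + b ^ 2) * gD a b u v - (2 * (a ^ 2 + b ^ 2) * v + -2 * b) ^ 2) = 0 := by
      unfold gD; ring
    refine mul_eq_zero_of_right _ ?_
    rw [sub_add_sub_comm, ← add_div, ← add_div, key1, key2]
    simp
end

section
/- Let h : ℝ → ℝ be continuous. Then the function u : ℝ² → ℝ defined by u(y) = -(1/(2π))·∫₀^{2π} ln‖y - z(θ)‖·h(θ) dθ, with z(θ) = (cos θ, sin θ), is harmonic on the open set {y ∈ ℝ² : ‖y‖ ≠ 1}; that is, u is twice continuously differentiable there and its Laplacian (sum of second partial derivatives) vanishes identically off the unit circle. -/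
open Real

/-- The point `z(θ) = (cos θ, sin θ)` on the unit circle, as a point of `ℝ²`. -/
noncomputable def unitCircle (θ : ℝ) : EuclideanSpace ℝ (Fin 2) :=
  (WithLp.equiv 2 (Fin 2 → ℝ)).symm ![Real.cos θ, Real.sin θ]

/-- The single layer potential on the unit circle with density `h`. -/
noncomputable def singleLayer (h : ℝ → ℝ) (y : EuclideanSpace ℝ (Fin 2)) : ℝ :=
  -(1 / (2 * Real.pi)) * ∫ θ in (0:ℝ)..(2 * Real.pi), Real.log ‖y - unitCircle θ‖ * h θ


/-- The real-linear functional `x ↦ Re (a x)`, as a function of `a`. -/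
noncomputable def slL : ℂ →L[ℝ] (ℂ →L[ℝ] ℝ) :=
  (ContinuousLinearMap.compL ℝ ℂ ℂ ℝ Complex.reCLM).comp (ContinuousLinearMap.mul ℝ ℂ)

lemma slL_apply (a x : ℂ) : slL a x = (a * x).re := rfl

lemma slL_norm (a : ℂ) : ‖slL a‖ ≤ ‖a‖ := by
  refine ContinuousLinearMap.opNorm_le_bound _ (norm_nonneg _) fun x => ?_
  rw [slL_apply, ← norm_mul]
  exact Complex.abs_re_le_norm _

/-- The circle point as a complex number. -/
noncomputable def slE (θ : ℝ) : ℂ := (Real.cos θ : ℂ) + (Real.sin θ : ℂ) * Complex.I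

lemma slE_cont : Continuous slE := by unfold slE; fun_prop

lemma slE_norm (θ : ℝ) : ‖slE θ‖ = 1 := by
  unfold slE
  push_cast
  rw [← Complex.exp_mul_I, Complex.norm_exp_ofReal_mul_I]

lemma slE_dist {w0 w : ℂ} {θ : ℝ} (hw : w ∈ Metric.ball w0 (|‖w0‖ - 1| / 2)) :
    |‖w0‖ - 1| / 2 ≤ ‖w - slE θ‖ := by
  have h1 := abs_norm_sub_norm_le w0 (slE θ)
  have h2 := norm_sub_le_norm_sub_add_norm_sub w0 w (slE θ)
  rw [Metric.mem_ball, dist_comm, dist_eq_norm] at hw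
  rw [slE_norm] at h1
  linarith

lemma slE_ne {w : ℂ} (hw : ‖w‖ ≠ 1) (θ : ℝ) : w - slE θ ≠ 0 := by
  intro h
  rw [sub_eq_zero] at h
  exact hw (by rw [h, slE_norm])

lemma hasFDerivAt_log_norm (c w : ℂ) (h : w - c ≠ 0) :
    HasFDerivAt (fun x : ℂ => Real.log ‖x - c‖) (slL (w - c)⁻¹) w := by
  have h1 : HasDerivAt (fun x : ℂ => Complex.log ((x - c) / (w - c))) ((w - c)⁻¹) w := by
    have := (((hasDerivAt_id w).sub_const c).div_const (w - c)).clog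
      (by simp [div_self h])
    simpa [div_self h] using this
  have h2 := (Complex.reCLM.hasFDerivAt.comp w (h1.hasFDerivAt.restrictScalars ℝ)).add_const
    (Real.log ‖w - c‖)
  have h3 : HasFDerivAt (fun x : ℂ => (Complex.log ((x - c) / (w - c))).re + Real.log ‖w - c‖)
      (slL (w - c)⁻¹) w := by
    refine h2.congr_fderiv ?_
    ext x
    simp [slL_apply]
    ring
  refine h3.congr_of_eventuallyEq ?_
  have : ∀ᶠ x in nhds w, x - c ≠ 0 :=
    (continuous_id.sub continuous_const).continuousAt.eventually_ne h
  filter_upwards [this] with x hx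
  rw [Complex.log_re, norm_div, Real.log_div (by simpa using hx) (by simpa using h)]
  ring

/-- Complex version of the potential (without constant). -/
noncomputable def slV (h : ℝ → ℝ) (w : ℂ) : ℝ :=
  ∫ θ in (0:ℝ)..(2 * Real.pi), Real.log ‖w - slE θ‖ * h θ

/-- The Cauchy-type integral. -/
noncomputable def slF (h : ℝ → ℝ) (w : ℂ) : ℂ :=
  ∫ θ in (0:ℝ)..(2 * Real.pi), (w - slE θ)⁻¹ * (h θ : ℂ)

lemma slU_open : IsOpen {w : ℂ | ‖w‖ ≠ 1} :=
  isOpen_ne_fun continuous_norm continuous_const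

lemma slInv_cont {w : ℂ} (hw : ‖w‖ ≠ 1) : Continuous (fun θ => (w - slE θ)⁻¹) :=
  (continuous_const.sub slE_cont).inv₀ (slE_ne hw)

lemma slBall {w0 : ℂ} (hw : ‖w0‖ ≠ 1) : 0 < |‖w0‖ - 1| / 2 :=
  half_pos (abs_pos.2 (sub_ne_zero.2 hw))

lemma slF_diff (h : ℝ → ℝ) (hh : Continuous h) (w0 : ℂ) (hw : ‖w0‖ ≠ 1) :
    DifferentiableAt ℂ (slF h) w0 := by
  have hd := slBall hw
  set δ := |‖w0‖ - 1| / 2 with hδ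
  have key := intervalIntegral.hasDerivAt_integral_of_dominated_loc_of_deriv_le
    (𝕜 := ℂ) (μ := MeasureTheory.volume) (a := 0) (b := 2 * Real.pi)
    (F := fun w θ => (w - slE θ)⁻¹ * (h θ : ℂ))
    (F' := fun w θ => (-1 / (w - slE θ) ^ 2) * (h θ : ℂ))
    (bound := fun θ => (1 / δ ^ 2) * |h θ|) (Metric.ball_mem_nhds w0 hd)
    ?_ ?_ ?_ ?_ ?_ ?_
  · exact key.2.differentiableAt
  · filter_upwards [slU_open.mem_nhds hw] with w hw'
    exact ((slInv_cont hw').mul (Complex.continuous_ofReal.comp hh)).aestronglyMeasurable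
  · exact ((slInv_cont hw).mul (Complex.continuous_ofReal.comp hh)).intervalIntegrable _ _
  · have : Continuous fun θ => (-1 / (w0 - slE θ) ^ 2) * (h θ : ℂ) :=
      (continuous_const.div ((continuous_const.sub slE_cont).pow 2)
        (fun θ => pow_ne_zero 2 (slE_ne hw θ))).mul (Complex.continuous_ofReal.comp hh)
    exact this.aestronglyMeasurable
  · refine Filter.Eventually.of_forall fun θ _ w hw' => ?_
    have := slE_dist (θ := θ) hw'
    rw [norm_mul, norm_div, norm_pow, norm_neg, norm_one, Complex.norm_real, Real.norm_eq_abs]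
    gcongr
  · exact (continuous_const.mul hh.abs).intervalIntegrable _ _
  · refine Filter.Eventually.of_forall fun θ _ w hw' => ?_
    have h0 : w - slE θ ≠ 0 := norm_pos_iff.1 (hd.trans_le (slE_dist (θ := θ) hw'))
    exact (((hasDerivAt_id w).sub_const (slE θ)).fun_inv h0).mul_const _

lemma slV_fderiv (h : ℝ → ℝ) (hh : Continuous h) (w0 : ℂ) (hw : ‖w0‖ ≠ 1) :
    HasFDerivAt (slV h) (slL (slF h w0)) w0 := by
  have hd := slBall hw
  set δ := |‖w0‖ - 1| / 2 with hδ
  have c1 : ∀ w : ℂ, ‖w‖ ≠ 1 → Continuous fun θ => Real.log ‖w - slE θ‖ * h θ := fun w hw' =>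
    ((continuous_const.sub slE_cont).norm.log fun θ => norm_ne_zero_iff.2 (slE_ne hw' θ)).mul hh
  have c2 : Continuous fun θ => (w0 - slE θ)⁻¹ * (h θ : ℂ) :=
    (slInv_cont hw).mul (Complex.continuous_ofReal.comp hh)
  have key := intervalIntegral.hasFDerivAt_integral_of_dominated_of_fderiv_le
    (𝕜 := ℝ) (μ := MeasureTheory.volume) (a := 0) (b := 2 * Real.pi)
    (F := fun (w : ℂ) θ => Real.log ‖w - slE θ‖ * h θ)
    (F' := fun w θ => slL ((w - slE θ)⁻¹ * (h θ : ℂ)))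
    (bound := fun θ => δ⁻¹ * |h θ|) (Metric.ball_mem_nhds w0 hd)
    ?_ ?_ ?_ ?_ ?_ ?_
  · rw [slL.intervalIntegral_comp_comm (c2.intervalIntegrable _ _)] at key
    exact key
  · filter_upwards [slU_open.mem_nhds hw] with w hw'
    exact (c1 w hw').aestronglyMeasurable
  · exact (c1 w0 hw).intervalIntegrable _ _
  · exact (slL.continuous.comp c2).aestronglyMeasurable
  · refine Filter.Eventually.of_forall fun θ _ w hw' => ?_
    have := slE_dist (θ := θ) hw'
    refine (slL_norm _).trans ?_
    rw [norm_mul, norm_inv, Complex.norm_real, Real.norm_eq_abs]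
    gcongr
  · exact (continuous_const.mul hh.abs).intervalIntegrable _ _
  · refine Filter.Eventually.of_forall fun θ _ w hw' => ?_
    have h0 : w - slE θ ≠ 0 := norm_pos_iff.1 (hd.trans_le (slE_dist (θ := θ) hw'))
    refine ((hasFDerivAt_log_norm (slE θ) w h0).mul_const (h θ)).congr_fderiv ?_
    ext x
    simp [slL_apply]
    ring

lemma slV_contDiffAt (h : ℝ → ℝ) (hh : Continuous h) (w0 : ℂ) (hw : ‖w0‖ ≠ 1) :
    ContDiffAt ℝ 2 (slV h) w0 := by
  have e : (2 : WithTop ℕ∞) = ((1 : ℕ) : WithTop ℕ∞) + 1 := by norm_num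
  rw [e, contDiffAt_succ_iff_hasFDerivAt]
  refine ⟨fun w => slL (slF h w), ⟨_, slU_open.mem_nhds hw, fun w hw' => slV_fderiv h hh w hw'⟩, ?_⟩
  have hF : DifferentiableOn ℂ (slF h) {w : ℂ | ‖w‖ ≠ 1} := fun w hw' =>
    (slF_diff h hh w hw').differentiableWithinAt
  have : ContDiffAt ℂ ((1 : ℕ) : WithTop ℕ∞) (slF h) w0 :=
    (hF.analyticAt (slU_open.mem_nhds hw)).contDiffAt
  exact slL.contDiff.contDiffAt.comp w0 (this.restrict_scalars ℝ)

lemma slV_second (h : ℝ → ℝ) (hh : Continuous h) (k : ℝ) (p d : ℂ) (t0 : ℝ)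
    (hw : ‖p + t0 * d‖ ≠ 1) :
    iteratedDeriv 2 (fun t : ℝ => k * slV h (p + t * d)) t0
      = k * (deriv (slF h) (p + t0 * d) * d ^ 2).re := by
  have hl : ∀ t : ℝ, HasDerivAt (fun t : ℝ => p + (t : ℂ) * d) d t := fun t => by
    simpa using ((Complex.ofRealCLM.hasDerivAt (x := t)).mul_const d).const_add p
  have hev : ∀ᶠ t : ℝ in nhds t0, ‖p + (t : ℂ) * d‖ ≠ 1 :=
    (hl t0).continuousAt.eventually (slU_open.mem_nhds hw)
  have h1 : deriv (fun t : ℝ => k * slV h (p + t * d)) =ᶠ[nhds t0]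
      fun t => k * (slF h (p + t * d) * d).re := by
    filter_upwards [hev] with t ht
    exact (((slV_fderiv h hh _ ht).comp_hasDerivAt t (hl t)).const_mul k).deriv
  rw [iteratedDeriv_succ, iteratedDeriv_one, h1.deriv_eq]
  have h2 : HasDerivAt (fun t : ℝ => slF h (p + t * d)) (deriv (slF h) (p + t0 * d) * d) t0 :=
    HasDerivAt.comp (𝕜 := ℝ) (𝕜' := ℂ) (h₂ := slF h) t0 (slF_diff h hh _ hw).hasDerivAt (hl t0)
  have h3 := ((Complex.reCLM.hasFDerivAt.comp_hasDerivAt t0 (h2.mul_const d)).const_mul k).deriv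
  refine h3.trans ?_
  simp only [Complex.reCLM_apply]
  congr 2
  ring

/-- Identification of the Euclidean plane with `ℂ`. -/
noncomputable def slJ : EuclideanSpace ℝ (Fin 2) ≃ₗᵢ[ℝ] ℂ :=
  Complex.orthonormalBasisOneI.repr.symm

lemma slJ_apply (y : EuclideanSpace ℝ (Fin 2)) : slJ y = y 0 + y 1 * Complex.I :=
  Complex.orthonormalBasisOneI_repr_symm_apply y

lemma singleLayer_eq (h : ℝ → ℝ) (y : EuclideanSpace ℝ (Fin 2)) :
    singleLayer h y = -(1 / (2 * Real.pi)) * slV h (slJ y) := by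
  unfold singleLayer slV
  congr 2
  ext θ
  have : slE θ = slJ (unitCircle θ) := by
    rw [slJ_apply]; simp [slE, unitCircle]
  rw [this, ← map_sub, LinearIsometryEquiv.norm_map]

/-- For continuous `h`, the single layer potential on the unit circle with density `h`
is harmonic off the unit circle: it is twice continuously differentiable on
`{y : ‖y‖ ≠ 1}` and the sum of its second partial derivatives vanishes there. -/
theorem single_layer_harmonic (h : ℝ → ℝ) (hh : Continuous h) :
    ContDiffOn ℝ 2 (singleLayer h) {y : EuclideanSpace ℝ (Fin 2) | ‖y‖ ≠ 1} ∧
    ∀ y : EuclideanSpace ℝ (Fin 2), ‖y‖ ≠ 1 →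
      (∑ i : Fin 2,
        iteratedDeriv 2 (fun t => singleLayer h (updateCoord y i t)) (y i)) = 0 := by
  have hU : ∀ y : EuclideanSpace ℝ (Fin 2), ‖y‖ ≠ 1 → ‖slJ y‖ ≠ 1 := fun y hy => by
    rwa [LinearIsometryEquiv.norm_map]
  have hS : singleLayer h = fun y => -(1 / (2 * Real.pi)) * slV h (slJ y) :=
    funext (singleLayer_eq h)
  refine ⟨fun y hy => ?_, fun y hy => ?_⟩
  · rw [hS]
    exact (contDiffAt_const.mul ((slV_contDiffAt h hh _ (hU y hy)).comp y
      slJ.toContinuousLinearEquiv.contDiff.contDiffAt)).contDiffWithinAt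
  · have e := hU y hy
    rw [slJ_apply] at e
    have e0 : (fun t => singleLayer h (updateCoord y 0 t)) =
        fun t : ℝ => -(1 / (2 * Real.pi)) * slV h (y 1 * Complex.I + t * 1) := by
      funext t
      rw [singleLayer_eq, slJ_apply]
      simp [updateCoord, add_comm]
    have e1 : (fun t => singleLayer h (updateCoord y 1 t)) =
        fun t : ℝ => -(1 / (2 * Real.pi)) * slV h (y 0 + t * Complex.I) := by
      funext t
      rw [singleLayer_eq, slJ_apply]
      simp [updateCoord]
    have e' : ((y 1 : ℂ) * Complex.I + y 0 * 1) = y 0 + y 1 * Complex.I := by ring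
    rw [Fin.sum_univ_two, e0, e1, slV_second h hh _ _ _ _ (by rw [e']; exact e),
      slV_second h hh _ _ _ _ e, e', Complex.I_sq]
    simp
end

section
/- Let h : ℝ → ℝ be continuous. Then the function u : ℝ² → ℝ defined by u(y) = -(1/(2π))·∫₀^{2π} ln‖y - z(θ)‖·h(θ) dθ, with z(θ) = (cos θ, sin θ), is well defined (the integral converges for every y, including points y on the unit circle) and u is continuous on all of ℝ²; in particular, for every boundary point y₀ with ‖y₀‖ = 1, lim_{y → y₀} u(y) = u(y₀). -/
open Real

open MeasureTheory Filter Topology in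
/-- Integrability of the logarithmic kernel, on the complex plane. -/
lemma slc_integrable (w : ℂ) :
    IntervalIntegrable (fun θ => Real.log ‖w - circleMap 0 1 θ‖) volume 0 (2 * π) := by
  have := circleIntegrable_log_norm_sub_const (a := w) (c := 0) 1
  unfold CircleIntegrable at this
  simpa only [norm_sub_rev] using this

open MeasureTheory Filter Topology in
lemma slc_integral (w : ℂ) :
    ∫ θ in (0:ℝ)..(2 * π), Real.log ‖w - circleMap 0 1 θ‖ = 2 * π * Real.posLog ‖w‖ := by
  have := circleAverage_log_norm_sub_const_eq_posLog (a := w)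
  rw [Real.circleAverage_def, smul_eq_mul] at this
  rw [← this]
  simp only [norm_sub_rev w]
  field_simp

open MeasureTheory Filter Topology in
lemma slc_ae (w : ℂ) : ∀ᵐ θ : ℝ, w - circleMap 0 1 θ ≠ 0 := by
  have hc : ((circleMap 0 1) ⁻¹' {w}).Countable :=
    (Set.countable_singleton w).preimage_circleMap 0 one_ne_zero
  filter_upwards [compl_mem_ae_iff.mpr (hc.measure_zero volume)] with θ hθ h0
  exact hθ (by simpa using (sub_eq_zero.mp h0).symm)

open MeasureTheory Filter Topology in
/-- The kernels converge in `L¹` as the parameter converges. -/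
lemma slc_L1 (w₀ : ℂ) :
    Tendsto (fun w : ℂ => ∫ θ in (0:ℝ)..(2 * π),
      |Real.log ‖w - circleMap 0 1 θ‖ - Real.log ‖w₀ - circleMap 0 1 θ‖|) (𝓝 w₀) (𝓝 0) := by
  have hmax : Tendsto (fun w : ℂ => ∫ θ in (0:ℝ)..(2 * π),
      max (Real.log ‖w - circleMap 0 1 θ‖) (Real.log ‖w₀ - circleMap 0 1 θ‖)) (𝓝 w₀)
      (𝓝 (∫ θ in (0:ℝ)..(2 * π), Real.log ‖w₀ - circleMap 0 1 θ‖)) := by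
    apply intervalIntegral.tendsto_integral_filter_of_dominated_convergence
      (fun θ => |Real.log ‖w₀ - circleMap 0 1 θ‖| + (‖w₀‖ + 2))
    · refine Eventually.of_forall fun w => ?_
      have h1 := (slc_integrable w).aestronglyMeasurable_restrict_uIoc
      have h2 := (slc_integrable w₀).aestronglyMeasurable_restrict_uIoc
      exact h1.sup h2
    · filter_upwards [Metric.ball_mem_nhds w₀ one_pos] with w hw
      refine Eventually.of_forall fun θ _ => ?_
      have hn : ‖w - circleMap 0 1 θ‖ ≤ ‖w₀‖ + 2 := by
        have h1 : ‖w - w₀‖ < 1 := by simpa [dist_eq_norm] using hw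
        have h2 : ‖circleMap 0 1 θ‖ = 1 := by simp
        have h3 := norm_add_le (w - w₀) (w₀ - circleMap 0 1 θ)
        have h4 := norm_sub_le w₀ (circleMap 0 1 θ)
        rw [sub_add_sub_cancel] at h3
        linarith
      have hl := Real.log_le_self (norm_nonneg (w - circleMap 0 1 θ))
      have h0 := norm_nonneg w₀
      have ha := neg_abs_le (Real.log ‖w₀ - circleMap 0 1 θ‖)
      have hb := le_abs_self (Real.log ‖w₀ - circleMap 0 1 θ‖)
      have hc := abs_nonneg (Real.log ‖w₀ - circleMap 0 1 θ‖)
      rw [Real.norm_eq_abs, abs_le]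
      exact ⟨le_max_of_le_right (by linarith), max_le (by linarith) (by linarith)⟩
    · exact (slc_integrable w₀).abs.add intervalIntegrable_const
    · filter_upwards [slc_ae w₀] with θ hθ _
      have h1 : ContinuousAt (fun w : ℂ => max (Real.log ‖w - circleMap 0 1 θ‖)
          (Real.log ‖w₀ - circleMap 0 1 θ‖)) w₀ := by
        refine ContinuousAt.sup (ContinuousAt.log (by fun_prop) ?_) continuousAt_const
        simpa using hθ
      simpa [ContinuousAt] using h1
  have hpos : Continuous (fun w : ℂ => 2 * π * Real.posLog ‖w‖) := by
    have := Real.continuous_posLog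
    fun_prop
  have hint : Tendsto (fun w : ℂ => ∫ θ in (0:ℝ)..(2 * π), Real.log ‖w - circleMap 0 1 θ‖)
      (𝓝 w₀) (𝓝 (∫ θ in (0:ℝ)..(2 * π), Real.log ‖w₀ - circleMap 0 1 θ‖)) := by
    simp only [slc_integral]
    exact hpos.tendsto w₀
  have key := ((hmax.const_mul 2).sub hint).sub
    (tendsto_const_nhds (x := ∫ θ in (0:ℝ)..(2 * π), Real.log ‖w₀ - circleMap 0 1 θ‖))
  convert key using 2 with w
  · have hm : IntervalIntegrable (fun θ => max (Real.log ‖w - circleMap 0 1 θ‖)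
        (Real.log ‖w₀ - circleMap 0 1 θ‖)) volume 0 (2 * π) :=
      ⟨(slc_integrable w).1.sup (slc_integrable w₀).1,
        (slc_integrable w).2.sup (slc_integrable w₀).2⟩
    rw [← intervalIntegral.integral_const_mul,
      ← intervalIntegral.integral_sub (hm.const_mul 2) (slc_integrable w),
      ← intervalIntegral.integral_sub ((hm.const_mul 2).sub (slc_integrable w)) (slc_integrable w₀)]
    congr 1
    funext θ
    rcases le_total (Real.log ‖w - circleMap 0 1 θ‖) (Real.log ‖w₀ - circleMap 0 1 θ‖) with h | h
    · rw [max_eq_right h, abs_of_nonpos (by linarith)]; ring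
    · rw [max_eq_left h, abs_of_nonneg (by linarith)]; ring
  · ring

open MeasureTheory Filter Topology in
lemma slc_integrable_mul (h : ℝ → ℝ) (hh : Continuous h) (w : ℂ) :
    IntervalIntegrable (fun θ => Real.log ‖w - circleMap 0 1 θ‖ * h θ) volume 0 (2 * π) :=
  (slc_integrable w).mul_continuousOn hh.continuousOn

open MeasureTheory Filter Topology in
lemma slc_continuous (h : ℝ → ℝ) (hh : Continuous h) :
    Continuous (fun w : ℂ => ∫ θ in (0:ℝ)..(2 * π), Real.log ‖w - circleMap 0 1 θ‖ * h θ) := by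
  obtain ⟨M, hM⟩ := (isCompact_Icc (a := (0:ℝ)) (b := 2 * π)).exists_bound_of_continuousOn
    hh.continuousOn
  have hpi : (0:ℝ) ≤ 2 * π := by positivity
  refine continuous_iff_continuousAt.mpr fun w₀ => ?_
  refine tendsto_iff_norm_sub_tendsto_zero.mpr ?_
  have hl := (slc_L1 w₀).mul_const M
  rw [zero_mul] at hl
  refine squeeze_zero (fun _ => norm_nonneg _) (fun w => ?_) hl
  rw [← intervalIntegral.integral_sub (slc_integrable_mul h hh w) (slc_integrable_mul h hh w₀),
    ← intervalIntegral.integral_mul_const]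
  refine intervalIntegral.norm_integral_le_of_norm_le hpi ?_
    (((slc_integrable w).sub (slc_integrable w₀)).abs.mul_const M)
  refine Eventually.of_forall fun θ hθ => ?_
  rw [← sub_mul, norm_mul, Real.norm_eq_abs]
  exact mul_le_mul_of_nonneg_left (hM θ ⟨hθ.1.le, hθ.2⟩) (abs_nonneg _)

lemma slc_norm (y : EuclideanSpace ℝ (Fin 2)) (θ : ℝ) :
    ‖y - unitCircle θ‖ = ‖Complex.orthonormalBasisOneI.repr.symm y - circleMap 0 1 θ‖ := by
  rw [← LinearIsometryEquiv.norm_map Complex.orthonormalBasisOneI.repr, map_sub,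
    LinearIsometryEquiv.apply_symm_apply]
  congr 2
  ext i
  fin_cases i <;> simp [unitCircle, circleMap, Complex.exp_ofReal_mul_I_re,
    Complex.exp_ofReal_mul_I_im]

/-- For continuous `h`, the single layer potential on the unit circle is well defined
(the integral converges for every `y`, including points on the circle) and is continuous
on all of `ℝ²`; in particular it attains its boundary values continuously:
for every `y₀` with `‖y₀‖ = 1`, `u(y) → u(y₀)` as `y → y₀`. -/
theorem single_layer_continuous (h : ℝ → ℝ) (hh : Continuous h) :
    (∀ y : EuclideanSpace ℝ (Fin 2),
      IntervalIntegrable (fun θ => Real.log ‖y - unitCircle θ‖ * h θ)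
        MeasureTheory.volume 0 (2 * π)) ∧
    Continuous (singleLayer h) ∧
    ∀ y₀ : EuclideanSpace ℝ (Fin 2), ‖y₀‖ = 1 →
      Filter.Tendsto (singleLayer h) (nhds y₀) (nhds (singleLayer h y₀)) := by
  have hc : Continuous (singleLayer h) := by
    unfold singleLayer
    simp only [slc_norm]
    exact continuous_const.mul
      ((slc_continuous h hh).comp Complex.orthonormalBasisOneI.repr.symm.continuous)
  refine ⟨fun y => ?_, hc, fun y₀ _ => hc.tendsto y₀⟩
  simp only [slc_norm]
  exact slc_integrable_mul h hh _
end
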